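/- Let β be a blanket for Adv(r) and let λ ∈ Neg(β). Then λ contains no pair of complementary extended literals (neither a strongly complementary pair nor a default complementary pair). -/

import Mathlib

/-! ## Classical and extended literals -/

/-- A classical literal over atoms `A`: an atom `a` (positive) or a strongly
negated atom `¬a` (negative). -/
inductive CLit (A : Type) : Type
  | pos : A → CLit A
  | neg : A → CLit A
deriving DecidableEq

namespace CLit

/-- The strong complement of a classical literal. -/
def compl {A : Type} : CLit A → CLit A
  | pos a => neg a
  | neg a => pos a

/-- The underlying atom of a classical literal. -/
def atom {A : Type} : CLit A → A
  | pos a => a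
  | neg a => a

end CLit

/-- Two classical literals are strongly complementary. -/
def StronglyComp {A : Type} (L L' : CLit A) : Prop := L' = L.compl

/-- A set of classical literals is consistent iff it contains no strongly
complementary pair. -/
def Consistent {A : Type} (S : Set (CLit A)) : Prop := ∀ L ∈ S, L.compl ∉ S

/-- An extended literal: a classical literal `L` or a default-negated
classical literal `not L`. -/
inductive ELit (A : Type) : Type
  | lit : CLit A → ELit A
  | not : CLit A → ELit A
deriving DecidableEq

namespace ELit

/-- The underlying atom of an extended literal. -/
def atom {A : Type} : ELit A → A
  | lit L => L.atom
  | not L => L.atom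

end ELit

/-- Two extended literals are atom-related iff they have the same underlying atom. -/
def AtomRelated {A : Type} (e e' : ELit A) : Prop := e.atom = e'.atom

/-- Strongly complementary extended literals: `L` and its strong complement. -/
def EStrComp {A : Type} (e e' : ELit A) : Prop :=
  ∃ L : CLit A, e = ELit.lit L ∧ e' = ELit.lit L.compl

/-- Default complementary extended literals: `L` and `not L`. -/
def EDefComp {A : Type} (e e' : ELit A) : Prop :=
  ∃ L : CLit A, (e = ELit.lit L ∧ e' = ELit.not L) ∨ (e = ELit.not L ∧ e' = ELit.lit L)

/-- Complementary extended literals: strongly or default complementary. -/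
def EComp {A : Type} (e e' : ELit A) : Prop := EStrComp e e' ∨ EDefComp e e'

/-- Dual extended literals: `L` and `not (strong complement of L)`. -/
def EDual {A : Type} (e e' : ELit A) : Prop :=
  ∃ L : CLit A, (e = ELit.lit L ∧ e' = ELit.not L.compl) ∨ (e = ELit.not L.compl ∧ e' = ELit.lit L)

/-- Reconcilable extended literals: `not L` and `not (strong complement of L)`. -/
def EReconc {A : Type} (e e' : ELit A) : Prop :=
  ∃ L : CLit A, e = ELit.not L ∧ e' = ELit.not L.compl

/-- Satisfaction of an extended literal by a set of classical literals:
`S ⊨ L` iff `L ∈ S`, and `S ⊨ not L` iff `L ∉ S`. -/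
def SatE {A : Type} (S : Set (CLit A)) : ELit A → Prop
  | ELit.lit L => L ∈ S
  | ELit.not L => L ∉ S

/-- A set `S` of classical literals satisfies a set `X` of extended literals
iff it satisfies every element of `X`. -/
def SatAll {A : Type} (S : Set (CLit A)) (X : Set (ELit A)) : Prop := ∀ e ∈ X, SatE S e

/-! ## Rules and programs -/

/-- A rule: a head (a classical literal) and a finite body of extended literals. -/
structure Rule (A : Type) where
  head : CLit A
  body : Finset (ELit A)

/-- The classical literals occurring positively in the body, `B⁺(r)`. -/
def Rule.bodyPos {A : Type} (r : Rule A) : Set (CLit A) := {L | ELit.lit L ∈ r.body}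

/-- The classical literals occurring default-negated in the body, `B⁻(r)`. -/
def Rule.bodyNeg {A : Type} (r : Rule A) : Set (CLit A) := {L | ELit.not L ∈ r.body}

/-- A rule is applicable iff some consistent set of classical literals
satisfies its body. -/
def Applicable {A : Type} (r : Rule A) : Prop :=
  ∃ S : Set (CLit A), Consistent S ∧ SatAll S ↑r.body

/-- Two rules `r ≠ r'` are conflicting iff their heads are strongly complementary
and some consistent set of classical literals satisfies both bodies. -/
def Conflicting {A : Type} (r r' : Rule A) : Prop :=
  r ≠ r' ∧ StronglyComp r.head r'.head ∧
    ∃ S : Set (CLit A), Consistent S ∧ SatAll S ↑r.body ∧ SatAll S ↑r'.body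

/-! ## Answer set semantics -/

/-- `S` is a model of the positive parts: for each rule, the head is in `S`
whenever the positive body is contained in `S`. -/
def PModel {A : Type} (P : Set (Rule A)) (S : Set (CLit A)) : Prop :=
  ∀ r ∈ P, r.bodyPos ⊆ S → r.head ∈ S

/-- The least model of a program without default negation. -/
def leastModel {A : Type} (P : Set (Rule A)) : Set (CLit A) := ⋂₀ {S | PModel P S}

open Classical in
/-- The answer set of a program without default negation: the least model if it
is consistent, and the set `Lit_A` of all classical literals otherwise. -/
noncomputable def posAnswerSet {A : Type} (P : Set (Rule A)) : Set (CLit A) :=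
  if Consistent (leastModel P) then leastModel P else Set.univ

/-- Whether an extended literal is a (positive occurrence of a) classical literal. -/
def ELit.isPos {A : Type} : ELit A → Bool
  | ELit.lit _ => true
  | ELit.not _ => false

/-- The reduct `P^S`: keep the rules with `B⁻(r) ∩ S = ∅`, as `H(r) ← B⁺(r)`. -/
def reduct {A : Type} (P : Set (Rule A)) (S : Set (CLit A)) : Set (Rule A) :=
  {r' | ∃ r ∈ P, r.bodyNeg ∩ S = ∅ ∧ r' = ⟨r.head, r.body.filter (fun e => e.isPos)⟩}

/-- `S` is an answer set of `P` iff `S` is the answer set of the reduct `P^S`. -/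
def AnswerSet {A : Type} (P : Set (Rule A)) (S : Set (CLit A)) : Prop :=
  S = posAnswerSet (reduct P S)

/-- The fact corresponding to a classical literal: a rule with empty body. -/
def fact {A : Type} (L : CLit A) : Rule A := ⟨L, ∅⟩

/-! ## Blankets and the negation operator -/

/-- The adversarial rules of `r` in the program `P`. -/
def Adv {A : Type} (P : Set (Rule A)) (r : Rule A) : Set (Rule A) :=
  {r' ∈ P | Conflicting r r'}

/-- The negation operator on extended literals:
`neg a = {not a, ¬a}`, `neg ¬a = {not ¬a, a}`, `neg (not a) = {a}`, `neg (not ¬a) = {¬a}`. -/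
def negE {A : Type} : ELit A → Set (ELit A)
  | ELit.lit L => {ELit.not L, ELit.lit L.compl}
  | ELit.not L => {ELit.lit L}

/-- `neg(e, X) = ⋂ {neg k : k ∈ X, k atom-related to e}`. -/
def negDep {A : Type} (e : ELit A) (X : Set (ELit A)) : Set (ELit A) :=
  ⋂ k ∈ {k ∈ X | AtomRelated k e}, negE k

/-- `Neg(X)`: all sets `T` of extended literals containing exactly one element of
each nonempty set `neg(e, X)` for `e ∈ X`, and nothing else. -/
def NegSets {A : Type} (X : Set (ELit A)) : Set (Set (ELit A)) :=
  {T | (∀ e ∈ X, (negDep e X).Nonempty → ∃! t, t ∈ T ∧ t ∈ negDep e X) ∧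
       (∀ t ∈ T, ∃ e ∈ X, t ∈ negDep e X)}

/-- All blanket conditions except `⊆`-minimality: nonempty, no complementary pair,
no reconcilable pair, atoms disjoint from the atoms of `B(r)`, and meeting the body
of every adversarial rule of `r`. -/
def PreBlanket {A : Type} (P : Set (Rule A)) (r : Rule A) (β : Set (ELit A)) : Prop :=
  β.Nonempty ∧
  (∀ e ∈ β, ∀ e' ∈ β, ¬ EComp e e') ∧
  (∀ e ∈ β, ∀ e' ∈ β, ¬ EReconc e e') ∧
  (∀ e ∈ β, ∀ e' ∈ r.body, e.atom ≠ ELit.atom e') ∧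
  (∀ rj ∈ Adv P r, ∃ e ∈ β, e ∈ rj.body)

/-- A blanket for `Adv(r)` (with ambient program `P`): a `⊆`-minimal set
satisfying the blanket conditions. -/
def Blanket {A : Type} (P : Set (Rule A)) (r : Rule A) (β : Set (ELit A)) : Prop :=
  PreBlanket P r β ∧ ∀ β' ⊆ β, PreBlanket P r β' → β' = β

theorem CLit.compl_ne {A : Type} (L : CLit A) : L.compl ≠ L := by
  cases L <;> simp [CLit.compl]

theorem CLit.atom_compl {A : Type} (L : CLit A) : L.compl.atom = L.atom := by
  cases L <;> rfl

/-- Complementary extended literals are distinct. -/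
theorem EComp.ne {A : Type} {e e' : ELit A} (h : EComp e e') : e ≠ e' := by
  rintro rfl
  rcases h with ⟨L, h₁, h₂⟩ | ⟨L, ⟨h₁, h₂⟩ | ⟨h₁, h₂⟩⟩
  · exact L.compl_ne (ELit.lit.inj (h₂.symm.trans h₁))
  · cases h₁.symm.trans h₂
  · cases h₁.symm.trans h₂

/-- Complementary extended literals have the same atom. -/
theorem EComp.atomRelated {A : Type} {e e' : ELit A} (h : EComp e e') : AtomRelated e e' := by
  rcases h with ⟨L, rfl, rfl⟩ | ⟨L, ⟨rfl, rfl⟩ | ⟨rfl, rfl⟩⟩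
  · exact L.atom_compl.symm
  · rfl
  · rfl

/-- The negation operator preserves the atom. -/
theorem atomRelated_of_mem_negE {A : Type} {e t : ELit A} (h : t ∈ negE e) :
    AtomRelated t e := by
  cases e with
  | lit L =>
    rcases h with rfl | rfl
    · rfl
    · exact L.atom_compl
  | not L =>
    cases h
    rfl

theorem atomRelated_of_mem_negDep {A : Type} {e t : ELit A} {X : Set (ELit A)} (he : e ∈ X)
    (h : t ∈ negDep e X) : AtomRelated t e :=
  atomRelated_of_mem_negE (Set.mem_iInter₂.mp h e ⟨he, rfl⟩)

/-- `neg(e, X)` depends on `e` only through its atom. -/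
theorem negDep_congr {A : Type} {e e' : ELit A} (X : Set (ELit A)) (h : AtomRelated e e') :
    negDep e X = negDep e' X := by
  unfold AtomRelated at h
  simp only [negDep, AtomRelated, h]

/-- Atom-related elements of a member of `Neg(X)` coincide. -/
theorem eq_of_mem_of_mem_NegSets {A : Type} {X T : Set (ELit A)} (hT : T ∈ NegSets X)
    {t t' : ELit A} (ht : t ∈ T) (ht' : t' ∈ T) (h : AtomRelated t t') : t = t' := by
  obtain ⟨k, hk, htk⟩ := hT.2 t ht
  obtain ⟨k', hk', htk'⟩ := hT.2 t' ht'
  have hkk' : AtomRelated k' k :=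
    (atomRelated_of_mem_negDep hk' htk').symm.trans
      (h.symm.trans (atomRelated_of_mem_negDep hk htk))
  rw [negDep_congr X hkk'] at htk'
  exact (hT.1 k hk ⟨t, htk⟩).unique ⟨ht, htk⟩ ⟨ht', htk'⟩

/-- For a blanket `β` for `Adv(r)` and `λ ∈ Neg(β)`: `λ` contains no
pair of complementary extended literals (neither strongly nor default complementary). -/
theorem stmt_8 {A : Type} (P : Set (Rule A)) (r : Rule A)
    (β : Set (ELit A)) (hβ : Blanket P r β)
    (lam : Set (ELit A)) (hlam : lam ∈ NegSets β) :
    ∀ e ∈ lam, ∀ e' ∈ lam, ¬ EComp e e' := by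
  intro e he e' he' h
  exact h.ne (eq_of_mem_of_mem_NegSets hlam he he' h.atomRelated)
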